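/- In the iterated construction built from a pair-instance B = (E, Φ, Γ, e₁, e₂): if for every X ∈ Φ there exists S ∈ Γ with e₁ S ∈ X and e₂ S ∈ X, then for every t : ℕ and every solution of the instance I_t there exists a scenario of I_t under which the cost of that solution is at least 2^{t+1}. -/

import Mathlib

/-- An instance: a finite type of edges, a nonempty finite family of feasible solutions
(finsets of edges), and scenarios indexed by a finite type, each scenario being a cost
function from edges to ℕ. -/
structure Inst where
  E : Type
  [fintE : Fintype E]
  [decE : DecidableEq E]
  sols : Finset (Finset E)
  sols_nonempty : sols.Nonempty
  Scen : Type
  [fintScen : Fintype Scen]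
  cost : Scen → E → ℕ

attribute [instance] Inst.fintE Inst.decE Inst.fintScen

/-- The cost of a solution `X` under scenario `S`. -/
def Inst.solCost (I : Inst) (X : Finset I.E) (S : I.Scen) : ℕ :=
  ∑ e ∈ X, I.cost S e

/-- A pair-instance: scenarios are indexed by a finite type `Scen` equipped with maps
`e₁ e₂ : Scen → E` with `e₁ S ≠ e₂ S`; the scenario of `S` gives cost 1 to `e₁ S` and
`e₂ S` and cost 0 to every other edge. -/
structure PairInst where
  E : Type
  [fintE : Fintype E]
  [decE : DecidableEq E]
  sols : Finset (Finset E)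
  sols_nonempty : sols.Nonempty
  Scen : Type
  [fintScen : Fintype Scen]
  e₁ : Scen → E
  e₂ : Scen → E
  ne : ∀ S, e₁ S ≠ e₂ S

attribute [instance] PairInst.fintE PairInst.decE PairInst.fintScen

/-- A pair-instance viewed as an instance, with the described 0/1 scenario costs. -/
def PairInst.toInst (B : PairInst) : Inst where
  E := B.E
  sols := B.sols
  sols_nonempty := B.sols_nonempty
  Scen := B.Scen
  cost := fun S e => if e = B.e₁ S ∨ e = B.e₂ S then 1 else 0

/-- The product solution `sol(X, f) = {(e, x) | e ∈ X, x ∈ f e}`. -/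
def PairInst.sol (B : PairInst) (I : Inst) (X : Finset B.E) (f : B.E → Finset I.E) :
    Finset (B.E × I.E) :=
  X.biUnion fun e => {e} ×ˢ f e

/-- The product of a pair-instance (outer) with an instance (inner). -/
def PairInst.prod (B : PairInst) (I : Inst) : Inst where
  E := B.E × I.E
  sols := (B.sols ×ˢ Fintype.piFinset fun _ : B.E => I.sols).image
    fun p => B.sol I p.1 p.2
  sols_nonempty := by
    obtain ⟨X, hX⟩ := B.sols_nonempty
    obtain ⟨Y, hY⟩ := I.sols_nonempty
    have hf : (fun _ : B.E => Y) ∈ Fintype.piFinset fun _ : B.E => I.sols :=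
      Fintype.mem_piFinset.mpr fun _ => hY
    exact Finset.Nonempty.image ⟨(X, fun _ => Y), Finset.mem_product.mpr ⟨hX, hf⟩⟩ _
  Scen := B.Scen × I.Scen × I.Scen
  cost := fun S p =>
    if p.1 = B.e₁ S.1 then I.cost S.2.1 p.2
    else if p.1 = B.e₂ S.1 then I.cost S.2.2 p.2
    else 0

/-- The iterated construction: `I_0 = B` and `I_{t+1} = B.prod I_t`. -/
def PairInst.iter (B : PairInst) : ℕ → Inst
  | 0 => B.toInst
  | t + 1 => B.prod (B.iter t)

/-- The cost of a product solution, summed edge by edge of the outer solution. -/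
theorem PairInst.solCost_sol (B : PairInst) (I : Inst) (X : Finset B.E)
    (f : B.E → Finset I.E) (S : (B.prod I).Scen) :
    (B.prod I).solCost (B.sol I X f) S = ∑ e ∈ X, ∑ x ∈ f e, (B.prod I).cost S (e, x) := by
  unfold Inst.solCost PairInst.sol
  refine (Finset.sum_biUnion ?_).trans (Finset.sum_congr rfl fun e _ => ?_)
  · intro a _ b _ hab
    exact Finset.disjoint_product.mpr (Or.inl (Finset.disjoint_singleton.mpr hab))
  · exact (Finset.sum_product _ _ _).trans (Finset.sum_singleton _ _)

/-- If an outer solution contains both edges of the scenario `S`, then the cost of a product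
solution is at least the sum of the costs of the two inner solutions at these edges. -/
theorem PairInst.add_le_solCost_sol (B : PairInst) (I : Inst) {X : Finset B.E}
    (f : B.E → Finset I.E) {S : B.Scen} (h₁ : B.e₁ S ∈ X) (h₂ : B.e₂ S ∈ X) (S₁ S₂ : I.Scen) :
    I.solCost (f (B.e₁ S)) S₁ + I.solCost (f (B.e₂ S)) S₂ ≤
      (B.prod I).solCost (B.sol I X f) (S, S₁, S₂) := by
  refine le_trans (le_trans (le_of_eq ?_) (Finset.add_le_sum (fun _ _ => Nat.zero_le _) h₁ h₂
    (B.ne S))) (B.solCost_sol I X f (S, S₁, S₂)).ge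
  simp [Inst.solCost, PairInst.prod, (B.ne S).symm]

/-- If an outer solution contains both edges of `S`, then its cost under `S` is at least `2`. -/
theorem PairInst.two_le_solCost (B : PairInst) {X : Finset B.E} {S : B.Scen}
    (h₁ : B.e₁ S ∈ X) (h₂ : B.e₂ S ∈ X) : 2 ≤ B.toInst.solCost X S := by
  refine le_trans (le_of_eq ?_)
    (Finset.add_le_sum (fun _ _ => Nat.zero_le _) h₁ h₂ (B.ne S))
  simp [PairInst.toInst]

/-- If every `X ∈ Φ` contains both `e₁ S` and `e₂ S` for some `S ∈ Γ`, then
for every `t` and every solution of `I_t` there is a scenario of `I_t` under which the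
cost of that solution is at least `2^(t+1)`. -/
theorem iter_lower_bound (B : PairInst)
    (h : ∀ X ∈ B.sols, ∃ S : B.Scen, B.e₁ S ∈ X ∧ B.e₂ S ∈ X) :
    ∀ t : ℕ, ∀ X ∈ (B.iter t).sols, ∃ S : (B.iter t).Scen,
      2 ^ (t + 1) ≤ (B.iter t).solCost X S := by
  intro t
  induction t with
  | zero =>
    intro X hX
    obtain ⟨S, h₁, h₂⟩ := h X hX
    exact ⟨S, B.two_le_solCost h₁ h₂⟩
  | succ t ih =>
    intro Y hY
    obtain ⟨⟨X, f⟩, hXf, rfl⟩ := Finset.mem_image.mp hY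
    obtain ⟨hX, hf⟩ := Finset.mem_product.mp hXf
    obtain ⟨S, h₁, h₂⟩ := h X hX
    obtain ⟨S₁, hS₁⟩ := ih _ (Fintype.mem_piFinset.mp hf (B.e₁ S))
    obtain ⟨S₂, hS₂⟩ := ih _ (Fintype.mem_piFinset.mp hf (B.e₂ S))
    refine ⟨(S, S₁, S₂), le_trans ?_ (B.add_le_solCost_sol (B.iter t) f h₁ h₂ S₁ S₂)⟩
    rw [pow_succ, mul_two]
    exact add_le_add hS₁ hS₂
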